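/- arXiv:1312.6631 — 2 statements merged into one kernel-verified Lean document; each statement's English description precedes it below -/
import Mathlib

section
/- Let M be an n×n real symmetric positive definite b-banded matrix with smallest eigenvalue λ_min and largest eigenvalue λ_max, λ_min < λ_max, and let S = M ⊗ I_n + I_n ⊗ M. For k, t ∈ {1, …, n²} set j = ⌊(t−1)/n⌋ + 1, i = t − n⌊(t−1)/n⌋, m = ⌊(k−1)/n⌋ + 1, ℓ = k − n⌊(k−1)/n⌋. For ω ∈ ℝ let α(ω) = (√(λ_min² + ω²) + √(λ_max² + ω²))/(λ_max − λ_min) and R(ω) = α(ω) + √(α(ω)² − 1). If exactly one of the equalities i = ℓ, j = m holds, then |(S⁻¹)_{k,t}| ≤ (1/(2π)) · (8/(λ_max − λ_min)) · ∫_{−∞}^{∞} (1/√(λ_min² + ω²)) · (R(ω)²/(R(ω)² − 1)²) · (1/R(ω))^{|i−ℓ|/b + |j−m|/b − 1} dω. -/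
open MeasureTheory Real Matrix

/-- The Kronecker sum `S = M ⊗ Iₙ + Iₙ ⊗ M`, written entrywise with 0-based
indices: for `k, t ∈ Fin (n*n)`, the row grid index is `k % n` and the column
grid index is `k / n` (vec convention stacking columns). -/
noncomputable def kronSum (n : ℕ) (M : Matrix (Fin n) (Fin n) ℝ) :
    Matrix (Fin (n * n)) (Fin (n * n)) ℝ := fun k t =>
  have hn : 0 < n := by
    rcases Nat.eq_zero_or_pos n with h | h
    · subst h; exact absurd k.2 (by simp)
    · exact h
  (if (k : ℕ) / n = (t : ℕ) / n then
      M ⟨(k : ℕ) % n, Nat.mod_lt _ hn⟩ ⟨(t : ℕ) % n, Nat.mod_lt _ hn⟩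
    else 0) +
  (if (k : ℕ) % n = (t : ℕ) % n then
      M ⟨(k : ℕ) / n, Nat.div_lt_of_lt_mul k.2⟩ ⟨(t : ℕ) / n, Nat.div_lt_of_lt_mul t.2⟩
    else 0)

lemma norm_div_one_sub_sub_const {u : ℂ} (hu : ‖u‖ < 1) :
    ‖u / (1 - u) - ((‖u‖ ^ 2 / (1 - ‖u‖ ^ 2) : ℝ) : ℂ)‖ = ‖u‖ / (1 - ‖u‖ ^ 2) := by
  have h1 : (1 - u) ≠ 0 := by
    intro h
    rw [← sub_eq_zero.mp h] at hu
    simp at hu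
  have hr : 0 < 1 - ‖u‖ ^ 2 := by nlinarith [norm_nonneg u]
  have h2 : ((1 - ‖u‖ ^ 2 : ℝ) : ℂ) ≠ 0 := by exact_mod_cast hr.ne'
  have h3 : u / (1 - u) - ((‖u‖ ^ 2 / (1 - ‖u‖ ^ 2) : ℝ) : ℂ)
      = u * (starRingEnd ℂ) (1 - u) / ((1 - u) * ((1 - ‖u‖ ^ 2 : ℝ) : ℂ)) := by
    have h4 : ((‖u‖ ^ 2 : ℝ) : ℂ) = u * (starRingEnd ℂ) u := by
      rw [Complex.mul_conj, Complex.normSq_eq_norm_sq]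
    rw [Complex.ofReal_div, div_sub_div _ _ h1 h2]
    congr 1
    rw [Complex.ofReal_sub, h4]
    simp
    ring
  rw [h3, norm_div, norm_mul, norm_mul, RCLike.norm_conj, Complex.norm_real, Real.norm_of_nonneg hr.le]
  have : ‖1 - u‖ ≠ 0 := norm_ne_zero_iff.mpr h1
  field_simp

open Polynomial in
/-- Polynomial approximation of `x ↦ (a - x)⁻¹` on `[-1, 1]` for `a = (q + q⁻¹) / 2`: a Chebyshev
partial sum whose last coefficient is modified so that the error is balanced on the circle. -/
lemma exists_polynomial_approx_inv_sub {q : ℂ} (hq0 : q ≠ 0) (hq : ‖q‖ < 1) (k : ℕ) :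
    ∃ P : ℂ[X], P.natDegree ≤ k ∧ ∀ x : ℝ, |x| ≤ 1 →
      ‖((q + q⁻¹) / 2 - x)⁻¹ - P.eval (x : ℂ)‖ ≤
        4 * (‖q‖ ^ 2 / (1 - ‖q‖ ^ 2) ^ 2) * ‖q‖ ^ k := by
  have hr : 0 < 1 - ‖q‖ ^ 2 := by nlinarith [norm_nonneg q]
  set c : ℂ := ((‖q‖ ^ 2 / (1 - ‖q‖ ^ 2) : ℝ) : ℂ) with hc
  refine ⟨C (4 * q / (1 - q ^ 2)) * (∑ j ∈ Finset.range (k + 1), C (q ^ j) * Chebyshev.T ℂ j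
    - C (1 / 2) + C (c * q ^ k) * Chebyshev.T ℂ k), ?_, ?_⟩
  · have hT : ∀ j : ℕ, (Chebyshev.T ℂ (j : ℤ)).natDegree ≤ j := by
      intro j
      simp [Chebyshev.natDegree_T]
    have hCT : ∀ (y : ℂ) (j : ℕ), j ≤ k → (C y * Chebyshev.T ℂ (j : ℤ)).natDegree ≤ k :=
      fun y j hj => (natDegree_C_mul_le _ _).trans ((hT j).trans hj)
    refine (natDegree_C_mul_le _ _).trans (natDegree_add_le_of_degree_le ?_ (hCT _ k le_rfl))
    refine natDegree_sub_le_of_le (n := k) (natDegree_sum_le_of_forall_le _ _ fun j hj =>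
      hCT _ j (by simpa [Nat.lt_succ_iff] using hj)) (by simp) |>.trans (by simp)
  intro x hx
  obtain ⟨hx1, hx2⟩ := abs_le.mp hx
  set θ : ℂ := (Real.arccos x : ℂ)
  set z : ℂ := Complex.exp (θ * Complex.I) with hz
  set v : ℂ := Complex.exp (-θ * Complex.I) with hv
  have hzv : z * v = 1 := by rw [hz, hv, ← Complex.exp_add]; simp
  have hxc : (x : ℂ) = Complex.cos θ := by
    rw [← Complex.ofReal_cos, Real.cos_arccos hx1 hx2]
  have hT : ∀ j : ℕ, (Chebyshev.T ℂ (j : ℤ)).eval (x : ℂ) = (z ^ j + v ^ j) / 2 := by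
    intro j
    rw [hxc, Chebyshev.T_complex_cos, Complex.cos, hz, hv, ← Complex.exp_nat_mul,
      ← Complex.exp_nat_mul]
    push_cast
    ring_nf
  have hxz : (x : ℂ) = (z + v) / 2 := by simpa using hT 1
  have nz : ‖z‖ = 1 := Complex.norm_exp_ofReal_mul_I _
  have nv : ‖v‖ = 1 := by
    rw [hv, ← Complex.ofReal_neg]; exact Complex.norm_exp_ofReal_mul_I _
  have ne1 : ∀ y : ℂ, ‖y‖ < 1 → 1 - y ≠ 0 := by
    intro y hy h
    rw [← sub_eq_zero.mp h] at hy
    simp at hy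
  have nqz : ‖q * z‖ = ‖q‖ := by rw [norm_mul, nz, mul_one]
  have nqv : ‖q * v‖ = ‖q‖ := by rw [norm_mul, nv, mul_one]
  have h1 : 1 - q * z ≠ 0 := ne1 _ (by rwa [nqz])
  have h2 : 1 - q * v ≠ 0 := ne1 _ (by rwa [nqv])
  have h3 : 1 - q ^ 2 ≠ 0 := ne1 _ (by rw [norm_pow]; linarith)
  have hsum : ∑ j ∈ Finset.range (k + 1), q ^ j * ((z ^ j + v ^ j) / 2)
      = ((1 - (q * z) ^ (k + 1)) / (1 - q * z) + (1 - (q * v) ^ (k + 1)) / (1 - q * v)) / 2 := by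
    rw [← mul_neg_geom_sum, ← mul_neg_geom_sum, mul_div_cancel_left₀ _ h1,
      mul_div_cancel_left₀ _ h2, ← Finset.sum_add_distrib, Finset.sum_div]
    refine Finset.sum_congr rfl fun j _ => ?_
    rw [mul_pow, mul_pow]; ring
  have hinv : ((q + q⁻¹) / 2 - x)⁻¹ = 4 * q / (1 - q ^ 2) *
      ((1 / (1 - q * z) + 1 / (1 - q * v)) / 2 - 1 / 2) := by
    have : (q + q⁻¹) / 2 - x = (1 - q * z) * (1 - q * v) / (2 * q) := by
      rw [hxz]
      field_simp
      linear_combination (-q ^ 2) * hzv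
    rw [this, inv_div]
    have h5 : (1 / (1 - q * z) + 1 / (1 - q * v)) / 2 - 1 / 2
        = (1 - q ^ 2) / (2 * ((1 - q * z) * (1 - q * v))) := by
      field_simp
      linear_combination (-q ^ 2) * hzv
    rw [h5]
    field_simp
    ring
  have key : ((q + q⁻¹) / 2 - x)⁻¹ - eval (x : ℂ) (C (4 * q / (1 - q ^ 2)) *
      (∑ j ∈ Finset.range (k + 1), C (q ^ j) * Chebyshev.T ℂ j
        - C (1 / 2) + C (c * q ^ k) * Chebyshev.T ℂ k)) =
      2 * q / (1 - q ^ 2) * q ^ k *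
        (z ^ k * (q * z / (1 - q * z) - c) + v ^ k * (q * v / (1 - q * v) - c)) := by
    simp only [eval_mul, eval_add, eval_sub, eval_C, eval_finsetSum, hT]
    rw [hsum, hinv]
    field_simp
    ring
  have bz : ‖q * z / (1 - q * z) - c‖ = ‖q‖ / (1 - ‖q‖ ^ 2) := by
    have := norm_div_one_sub_sub_const (u := q * z) (by rwa [nqz])
    rwa [nqz] at this
  have bv : ‖q * v / (1 - q * v) - c‖ = ‖q‖ / (1 - ‖q‖ ^ 2) := by
    have := norm_div_one_sub_sub_const (u := q * v) (by rwa [nqv])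
    rwa [nqv] at this
  have b3 : 1 - ‖q‖ ^ 2 ≤ ‖1 - q ^ 2‖ := by
    have := norm_sub_norm_le (1 : ℂ) (q ^ 2)
    rwa [norm_one, norm_pow] at this
  have b4 : ‖z ^ k * (q * z / (1 - q * z) - c) + v ^ k * (q * v / (1 - q * v) - c)‖
      ≤ 2 * (‖q‖ / (1 - ‖q‖ ^ 2)) := by
    refine (norm_add_le _ _).trans ?_
    rw [norm_mul, norm_mul, norm_pow, norm_pow, nz, nv, bz, bv]
    simp [two_mul]
  rw [key, norm_mul, norm_mul, norm_div, norm_mul, norm_pow, Complex.norm_ofNat]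
  calc 2 * ‖q‖ / ‖1 - q ^ 2‖ * ‖q‖ ^ k * _
      ≤ 2 * ‖q‖ / (1 - ‖q‖ ^ 2) * ‖q‖ ^ k * (2 * (‖q‖ / (1 - ‖q‖ ^ 2))) := by gcongr
    _ = _ := by
      field_simp
      ring

lemma exists_joukowski_preimage (a : ℂ) {A : ℝ} (hA : 1 < A) (ha : ‖a - 1‖ + ‖a + 1‖ = 2 * A) :
    ∃ q : ℂ, q ≠ 0 ∧ ‖q‖ < 1 ∧ (q + q⁻¹) / 2 = a ∧ ‖q‖⁻¹ = A + √(A ^ 2 - 1) := by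
  have norm_sum : ∀ q : ℂ, q ≠ 0 → (q + q⁻¹) / 2 = a → ‖q‖ + ‖q‖⁻¹ = 2 * A := by
    intro q hq h
    have hq' : ‖q‖ ≠ 0 := norm_ne_zero_iff.mpr hq
    have e1 : a - 1 = (q - 1) ^ 2 / (2 * q) := by rw [← h]; field_simp; ring
    have e2 : a + 1 = (q + 1) ^ 2 / (2 * q) := by rw [← h]; field_simp; ring
    rw [e1, e2] at ha
    simp only [norm_div, norm_mul, norm_pow, Complex.norm_ofNat] at ha
    have := parallelogram_law_with_norm ℝ q 1
    rw [norm_one] at this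
    rw [← ha]
    field_simp
    nlinarith
  obtain ⟨q, hq0, hq1, hqa⟩ : ∃ q : ℂ, q ≠ 0 ∧ ‖q‖ ≤ 1 ∧ (q + q⁻¹) / 2 = a := by
    obtain ⟨θ, hθ⟩ := Complex.cos_surjective a
    have h : (Complex.exp (θ * Complex.I) + (Complex.exp (θ * Complex.I))⁻¹) / 2 = a := by
      rw [← hθ, Complex.cos, ← Complex.exp_neg, neg_mul]
    rcases le_total ‖Complex.exp (θ * Complex.I)‖ 1 with h1 | h1
    · exact ⟨_, Complex.exp_ne_zero _, h1, h⟩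
    · refine ⟨(Complex.exp (θ * Complex.I))⁻¹, inv_ne_zero (Complex.exp_ne_zero _), ?_, ?_⟩
      · rw [norm_inv]; exact inv_le_one_of_one_le₀ h1
      · rw [inv_inv, add_comm]; exact h
  have hs := norm_sum q hq0 hqa
  have hpos : 0 < ‖q‖ := norm_pos_iff.mpr hq0
  have hlt : ‖q‖ < 1 := by
    rcases hq1.lt_or_eq with h | h
    · exact h
    · rw [h] at hs; norm_num at hs; linarith
  refine ⟨q, hq0, hlt, hqa, ?_⟩
  have hinv : 1 < ‖q‖⁻¹ := (one_lt_inv₀ hpos).mpr hlt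
  have hmul : ‖q‖ * ‖q‖⁻¹ = 1 := mul_inv_cancel₀ hpos.ne'
  have : √(A ^ 2 - 1) = ‖q‖⁻¹ - A := by
    rw [show A ^ 2 - 1 = (‖q‖⁻¹ - A) ^ 2 by nlinarith, Real.sqrt_sq (by linarith)]
  rw [this]; ring

lemma integrable_div_sq_add_sq {x : ℝ} (hx : 0 < x) :
    Integrable fun ω : ℝ => x / (x ^ 2 + ω ^ 2) := by
  have h := (integrable_inv_one_add_sq.comp_mul_left' (inv_ne_zero hx.ne')).const_mul x⁻¹
  refine h.congr (Filter.Eventually.of_forall fun ω => ?_)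
  simp only
  field_simp

lemma integral_univ_div_sq_add_sq {x : ℝ} (hx : 0 < x) :
    ∫ ω : ℝ, x / (x ^ 2 + ω ^ 2) = π := by
  have h : ∀ ω : ℝ, x / (x ^ 2 + ω ^ 2) = x⁻¹ * (1 + (x⁻¹ * ω) ^ 2)⁻¹ := fun ω => by
    field_simp
  simp_rw [h]
  rw [integral_const_mul, Measure.integral_comp_mul_left (fun y : ℝ => (1 + y ^ 2)⁻¹),
    integral_univ_inv_one_add_sq, inv_inv, abs_of_pos hx, smul_eq_mul, inv_mul_cancel_left₀ hx.ne']

lemma re_resolvent_mul {x y : ℝ} (hx : 0 < x) (hy : 0 < y) (ω : ℝ) :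
    ((x + ω * Complex.I : ℂ)⁻¹ * (y - ω * Complex.I : ℂ)⁻¹).re =
      (x + y)⁻¹ * (x / (x ^ 2 + ω ^ 2) + y / (y ^ 2 + ω ^ 2)) := by
  have h1 : x ^ 2 + ω ^ 2 ≠ 0 := by positivity
  have h2 : y ^ 2 + ω ^ 2 ≠ 0 := by positivity
  have h3 : x + y ≠ 0 := by positivity
  simp [Complex.mul_re, Complex.inv_re, Complex.inv_im, Complex.normSq_apply, ← sq]
  field_simp
  ring

lemma integrable_re_resolvent_mul {x y : ℝ} (hx : 0 < x) (hy : 0 < y) :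
    Integrable fun ω : ℝ => ((x + ω * Complex.I : ℂ)⁻¹ * (y - ω * Complex.I : ℂ)⁻¹).re := by
  simp_rw [re_resolvent_mul hx hy]
  exact ((integrable_div_sq_add_sq hx).add (integrable_div_sq_add_sq hy)).const_mul _

lemma integral_re_resolvent_mul {x y : ℝ} (hx : 0 < x) (hy : 0 < y) :
    ∫ ω : ℝ, ((x + ω * Complex.I : ℂ)⁻¹ * (y - ω * Complex.I : ℂ)⁻¹).re = 2 * π * (x + y)⁻¹ := by
  simp_rw [re_resolvent_mul hx hy]
  rw [integral_const_mul, integral_add (integrable_div_sq_add_sq hx) (integrable_div_sq_add_sq hy),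
    integral_univ_div_sq_add_sq hx, integral_univ_div_sq_add_sq hy]
  ring

open Kronecker in
lemma kronSum_eq_submatrix (n : ℕ) (M : Matrix (Fin n) (Fin n) ℝ) :
    kronSum n M = ((1 : Matrix (Fin n) (Fin n) ℝ) ⊗ₖ M + M ⊗ₖ 1).submatrix
      finProdFinEquiv.symm finProdFinEquiv.symm := by
  ext k t
  simp [kronSum, Matrix.one_apply, Fin.ext_iff, Fin.divNat, Fin.modNat]

open Kronecker in
lemma kronSum_inv_apply {n : ℕ} {M U : Matrix (Fin n) (Fin n) ℝ} {d : Fin n → ℝ}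
    (hd : ∀ p, 0 < d p) (hU : U * Uᵀ = 1) (hU' : Uᵀ * U = 1) (hM : M = U * diagonal d * Uᵀ)
    (k t : Fin (n * n)) :
    (kronSum n M)⁻¹ k t = ∑ p, ∑ q, (U k.modNat p * U t.modNat p) *
      (U k.divNat q * U t.divNat q) * (d p + d q)⁻¹ := by
  have hVV : (U ⊗ₖ U) * (Uᵀ ⊗ₖ Uᵀ) = 1 := by
    rw [← mul_kronecker_mul, hU, one_kronecker_one]
  have hVV' : (Uᵀ ⊗ₖ Uᵀ) * (U ⊗ₖ U) = 1 := by
    rw [← mul_kronecker_mul, hU', one_kronecker_one]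
  have hK : (1 : Matrix (Fin n) (Fin n) ℝ) ⊗ₖ M + M ⊗ₖ 1 =
      (U ⊗ₖ U) * diagonal (fun x : Fin n × Fin n => d x.2 + d x.1) * (Uᵀ ⊗ₖ Uᵀ) := by
    have h1 : diagonal (fun x : Fin n × Fin n => d x.2 + d x.1)
        = (1 : Matrix (Fin n) (Fin n) ℝ) ⊗ₖ diagonal d + diagonal d ⊗ₖ 1 := by
      rw [← diagonal_one, diagonal_kronecker_diagonal, diagonal_kronecker_diagonal, diagonal_add]
      simp
    rw [h1, mul_add, add_mul, ← mul_kronecker_mul, ← mul_kronecker_mul, ← mul_kronecker_mul,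
      ← mul_kronecker_mul, mul_one, hU, ← hM]
  have hinv : ((1 : Matrix (Fin n) (Fin n) ℝ) ⊗ₖ M + M ⊗ₖ 1)⁻¹ =
      (U ⊗ₖ U) * diagonal (fun x : Fin n × Fin n => (d x.2 + d x.1)⁻¹) * (Uᵀ ⊗ₖ Uᵀ) := by
    apply inv_eq_right_inv
    rw [hK]
    calc (U ⊗ₖ U) * diagonal (fun x : Fin n × Fin n => d x.2 + d x.1) * (Uᵀ ⊗ₖ Uᵀ) *
          ((U ⊗ₖ U) * diagonal (fun x : Fin n × Fin n => (d x.2 + d x.1)⁻¹) * (Uᵀ ⊗ₖ Uᵀ))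
        = (U ⊗ₖ U) * (diagonal (fun x : Fin n × Fin n => d x.2 + d x.1) *
          ((Uᵀ ⊗ₖ Uᵀ) * (U ⊗ₖ U)) *
          diagonal (fun x : Fin n × Fin n => (d x.2 + d x.1)⁻¹)) * (Uᵀ ⊗ₖ Uᵀ) := by
          simp only [mul_assoc]
      _ = 1 := by
          rw [hVV', mul_one, diagonal_mul_diagonal]
          have : (fun x : Fin n × Fin n => (d x.2 + d x.1) * (d x.2 + d x.1)⁻¹) = fun _ => 1 :=
            funext fun x => mul_inv_cancel₀ (add_pos (hd _) (hd _)).ne'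
          rw [this, diagonal_one, mul_one, hVV]
  rw [kronSum_eq_submatrix, inv_submatrix_equiv, submatrix_apply, hinv, mul_apply,
    Fintype.sum_prod_type, Finset.sum_comm]
  refine Finset.sum_congr rfl fun p _ => Finset.sum_congr rfl fun q _ => ?_
  rw [mul_diagonal]
  simp [kroneckerMap_apply]
  ring

/-- Entry `(a, c)` of `(U diag(d) Uᵀ + s)⁻¹`, for `U` orthogonal. -/
noncomputable def spectralResolvent {n : ℕ} (U : Matrix (Fin n) (Fin n) ℝ) (d : Fin n → ℝ)
    (s : ℂ) (a c : Fin n) : ℂ :=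
  ∑ p, (U a p * U c p : ℝ) * (d p + s)⁻¹

lemma kronSum_inv_apply_eq_integral {n : ℕ} {M U : Matrix (Fin n) (Fin n) ℝ} {d : Fin n → ℝ}
    (hd : ∀ p, 0 < d p) (hU : U * Uᵀ = 1) (hU' : Uᵀ * U = 1) (hM : M = U * diagonal d * Uᵀ)
    (k t : Fin (n * n)) :
    (kronSum n M)⁻¹ k t = 1 / (2 * π) * ∫ ω : ℝ,
      (spectralResolvent U d (ω * Complex.I) k.modNat t.modNat *
        spectralResolvent U d (-(ω * Complex.I)) k.divNat t.divNat).re := by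
  have h : ∀ ω : ℝ, (spectralResolvent U d (ω * Complex.I) k.modNat t.modNat *
        spectralResolvent U d (-(ω * Complex.I)) k.divNat t.divNat).re =
      ∑ p, ∑ q, (U k.modNat p * U t.modNat p) * (U k.divNat q * U t.divNat q) *
        ((d p + ω * Complex.I : ℂ)⁻¹ * (d q - ω * Complex.I : ℂ)⁻¹).re := by
    intro ω
    simp only [spectralResolvent, Finset.sum_mul_sum, Complex.re_sum]
    refine Finset.sum_congr rfl fun p _ => Finset.sum_congr rfl fun q _ => ?_
    rw [mul_mul_mul_comm, ← Complex.ofReal_mul, Complex.re_ofReal_mul, sub_eq_add_neg]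
  have hint : ∀ p q, Integrable fun ω : ℝ =>
      (U k.modNat p * U t.modNat p) * (U k.divNat q * U t.divNat q) *
        ((d p + ω * Complex.I : ℂ)⁻¹ * (d q - ω * Complex.I : ℂ)⁻¹).re :=
    fun p q => (integrable_re_resolvent_mul (hd p) (hd q)).const_mul _
  simp_rw [h]
  rw [kronSum_inv_apply hd hU hU' hM,
    integral_finsetSum _ fun p _ => integrable_finsetSum _ fun q _ => hint p q, Finset.mul_sum]
  refine Finset.sum_congr rfl fun p _ => ?_
  rw [integral_finsetSum _ fun q _ => hint p q, Finset.mul_sum]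
  refine Finset.sum_congr rfl fun q _ => ?_
  rw [integral_const_mul, integral_re_resolvent_mul (hd p) (hd q)]
  field_simp

lemma sum_abs_mul_abs_le_one {n : ℕ} {U : Matrix (Fin n) (Fin n) ℝ} (hU : U * Uᵀ = 1)
    (a c : Fin n) : ∑ p, |U a p * U c p| ≤ 1 := by
  have hrow : ∀ a, ∑ p, U a p ^ 2 = 1 := fun a => by
    have := congrFun (congrFun hU a) a
    simpa [mul_apply, sq] using this
  calc ∑ p, |U a p * U c p| ≤ ∑ p, (U a p ^ 2 + U c p ^ 2) / 2 := by
        refine Finset.sum_le_sum fun p _ => abs_le.mpr ⟨?_, ?_⟩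
        · nlinarith [sq_nonneg (U a p + U c p)]
        · nlinarith [sq_nonneg (U a p - U c p)]
    _ = 1 := by rw [← Finset.sum_div, Finset.sum_add_distrib, hrow, hrow]; norm_num

lemma norm_sum_mul_le {n : ℕ} {U : Matrix (Fin n) (Fin n) ℝ} (hU : U * Uᵀ = 1)
    (a c : Fin n) (f : Fin n → ℂ) {C : ℝ} (hC : 0 ≤ C) (hf : ∀ p, ‖f p‖ ≤ C) :
    ‖∑ p, (U a p * U c p : ℝ) * f p‖ ≤ C := by
  calc ‖∑ p, (U a p * U c p : ℝ) * f p‖ ≤ ∑ p, |U a p * U c p| * C := by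
        refine norm_sum_le_of_le _ fun p _ => ?_
        rw [norm_mul, Complex.norm_real, Real.norm_eq_abs]
        gcongr
        exact hf p
    _ ≤ 1 * C := by
        rw [← Finset.sum_mul]
        gcongr
        exact sum_abs_mul_abs_le_one hU a c
    _ = C := one_mul C

lemma norm_spectralResolvent_le {n : ℕ} {U : Matrix (Fin n) (Fin n) ℝ} {d : Fin n → ℝ} {l : ℝ}
    (hU : U * Uᵀ = 1) (hl : 0 < l) (hd : ∀ p, l ≤ d p) (ω : ℝ) (a c : Fin n) :
    ‖spectralResolvent U d (ω * Complex.I) a c‖ ≤ 1 / √(l ^ 2 + ω ^ 2) := by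
  refine norm_sum_mul_le hU a c _ (by positivity) fun p => ?_
  rw [norm_inv, Complex.norm_add_mul_I, ← one_div]
  have := hd p
  gcongr

/-- Major semi-axis of the ellipse with foci `±1` through the shift `-iω`, after the interval
`[l, u]` is mapped affinely onto `[-1, 1]`. -/
noncomputable def bernsteinSemiaxis (l u ω : ℝ) : ℝ :=
  (√(l ^ 2 + ω ^ 2) + √(u ^ 2 + ω ^ 2)) / (u - l)

/-- Sum of the semi-axes of the ellipse with major semi-axis `bernsteinSemiaxis l u ω`. -/
noncomputable def bernsteinRadius (l u ω : ℝ) : ℝ :=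
  bernsteinSemiaxis l u ω + √(bernsteinSemiaxis l u ω ^ 2 - 1)

lemma bernsteinRadius_neg (l u ω : ℝ) : bernsteinRadius l u (-ω) = bernsteinRadius l u ω := by
  simp [bernsteinRadius, bernsteinSemiaxis]

lemma le_bernsteinSemiaxis {l u : ℝ} (hlu : l < u) (ω : ℝ) :
    (u + l) / (u - l) ≤ bernsteinSemiaxis l u ω := by
  have h1 : l ≤ √(l ^ 2 + ω ^ 2) := Real.le_sqrt_of_sq_le (by nlinarith)
  have h2 : u ≤ √(u ^ 2 + ω ^ 2) := Real.le_sqrt_of_sq_le (by nlinarith)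
  have : 0 < u - l := sub_pos.mpr hlu
  exact div_le_div_of_nonneg_right (by linarith) this.le

lemma one_lt_bernsteinSemiaxis {l u : ℝ} (hl : 0 < l) (hlu : l < u) (ω : ℝ) :
    1 < bernsteinSemiaxis l u ω :=
  lt_of_lt_of_le ((one_lt_div (sub_pos.mpr hlu)).mpr (by linarith)) (le_bernsteinSemiaxis hlu ω)

lemma bernsteinSemiaxis_le_radius (l u ω : ℝ) :
    bernsteinSemiaxis l u ω ≤ bernsteinRadius l u ω :=
  le_add_of_nonneg_right (Real.sqrt_nonneg _)

lemma one_lt_bernsteinRadius {l u : ℝ} (hl : 0 < l) (hlu : l < u) (ω : ℝ) :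
    1 < bernsteinRadius l u ω :=
  (one_lt_bernsteinSemiaxis hl hlu ω).trans_le (bernsteinSemiaxis_le_radius l u ω)

open Polynomial in
lemma norm_spectralResolvent_le_of_moments {n : ℕ} {U : Matrix (Fin n) (Fin n) ℝ}
    {d : Fin n → ℝ} {l u : ℝ} (hU : U * Uᵀ = 1) (hl : 0 < l) (hlu : l < u)
    (hdl : ∀ p, l ≤ d p) (hdu : ∀ p, d p ≤ u) (ω : ℝ) {a c : Fin n} {k : ℕ}
    (hmom : ∀ s ≤ k, ∑ p, U a p * U c p * d p ^ s = 0) :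
    ‖spectralResolvent U d (ω * Complex.I) a c‖ ≤ 8 / (u - l) *
      (bernsteinRadius l u ω ^ 2 / (bernsteinRadius l u ω ^ 2 - 1) ^ 2) *
        (1 / bernsteinRadius l u ω) ^ k := by
  have hδ : 0 < u - l := sub_pos.mpr hlu
  have hδc : (u - l : ℂ) ≠ 0 := by exact_mod_cast hδ.ne'
  have hnorm : ∀ y : ℝ, ‖-(2 * (y + ω * Complex.I) / (u - l : ℂ))‖
      = 2 * √(y ^ 2 + ω ^ 2) / (u - l) := fun y => by
    rw [norm_neg, norm_div, norm_mul, Complex.norm_ofNat, Complex.norm_add_mul_I,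
      ← Complex.ofReal_sub, Complex.norm_real, Real.norm_of_nonneg hδ.le]
  obtain ⟨q, hq0, hq1, hqa, hqR⟩ := exists_joukowski_preimage
    (-((u + l + 2 * ω * Complex.I) / (u - l : ℂ))) (one_lt_bernsteinSemiaxis hl hlu ω) (by
      have e1 : -((u + l + 2 * ω * Complex.I) / (u - l : ℂ)) - 1
          = -(2 * (u + ω * Complex.I) / (u - l : ℂ)) := by field_simp; ring
      have e2 : -((u + l + 2 * ω * Complex.I) / (u - l : ℂ)) + 1
          = -(2 * (l + ω * Complex.I) / (u - l : ℂ)) := by field_simp; ring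
      rw [e1, e2, hnorm, hnorm, bernsteinSemiaxis]
      ring)
  obtain ⟨P, hPk, hP⟩ := exists_polynomial_approx_inv_sub hq0 hq1 k
  rw [hqa] at hP
  change _ = bernsteinRadius l u ω at hqR
  set x : Fin n → ℝ := fun p => (2 * d p - u - l) / (u - l) with hx
  have hx1 : ∀ p, |x p| ≤ 1 := fun p => by
    have := hdl p
    have := hdu p
    rw [hx, abs_le, le_div_iff₀ hδ, div_le_iff₀ hδ]
    constructor <;> linarith
  set Q : ℂ[X] := P.comp (C (2 / (u - l) : ℂ) * X + C (-(u + l) / (u - l) : ℂ)) with hQ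
  have hQk : Q.natDegree < k + 1 := by
    refine Nat.lt_succ_of_le (natDegree_comp_le.trans ?_)
    calc P.natDegree * _ ≤ k * 1 := Nat.mul_le_mul hPk natDegree_linear_le
      _ = k := mul_one k
  have hPx : ∀ p, P.eval (x p : ℂ) = Q.eval (d p : ℂ) := fun p => by
    rw [hQ, eval_comp, hx]
    simp only [eval_add, eval_mul, eval_C, eval_X]
    congr 1
    push_cast
    ring
  have hsum0 : ∑ p, (U a p * U c p : ℝ) * P.eval (x p : ℂ) = 0 := by
    simp_rw [hPx, eval_eq_sum_range' hQk, Finset.mul_sum]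
    rw [Finset.sum_comm]
    refine Finset.sum_eq_zero fun s hs => ?_
    have h := congrArg (Complex.ofReal) (hmom s (Nat.lt_succ_iff.mp (Finset.mem_range.mp hs)))
    rw [Complex.ofReal_zero, Complex.ofReal_sum] at h
    rw [← mul_zero (Q.coeff s), ← h, Finset.mul_sum]
    refine Finset.sum_congr rfl fun p _ => ?_
    push_cast
    ring
  have hres : spectralResolvent U d (ω * Complex.I) a c = ∑ p, (U a p * U c p : ℝ) *
      (-(2 / (u - l) : ℂ) * ((-((u + l + 2 * ω * Complex.I) / (u - l : ℂ)) - x p)⁻¹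
        - P.eval (x p : ℂ))) := by
    have : ∀ p, (U a p * U c p : ℝ) *
        (-(2 / (u - l) : ℂ) * ((-((u + l + 2 * ω * Complex.I) / (u - l : ℂ)) - x p)⁻¹
        - P.eval (x p : ℂ))) = (U a p * U c p : ℝ) * (d p + ω * Complex.I)⁻¹
        + (2 / (u - l) : ℂ) * ((U a p * U c p : ℝ) * P.eval (x p : ℂ)) := fun p => by
      have e : -((u + l + 2 * ω * Complex.I) / (u - l : ℂ)) - x p
          = -(2 / (u - l) : ℂ) * (d p + ω * Complex.I) := by
        rw [hx]
        push_cast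
        field_simp
        ring
      have e' : -(2 / (u - l) : ℂ) ≠ 0 := neg_ne_zero.mpr (div_ne_zero two_ne_zero hδc)
      rw [e, mul_inv, mul_sub, mul_inv_cancel_left₀ e']
      ring
    simp_rw [this]
    rw [Finset.sum_add_distrib, ← Finset.mul_sum, hsum0, mul_zero, add_zero, spectralResolvent]
  have hq' : ‖q‖ = 1 / bernsteinRadius l u ω := by rw [← hqR, one_div, inv_inv]
  have hR := one_lt_bernsteinRadius hl hlu ω
  have hbound : 2 / (u - l) * (4 * (‖q‖ ^ 2 / (1 - ‖q‖ ^ 2) ^ 2) * ‖q‖ ^ k) = 8 / (u - l) *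
      (bernsteinRadius l u ω ^ 2 / (bernsteinRadius l u ω ^ 2 - 1) ^ 2) *
        (1 / bernsteinRadius l u ω) ^ k := by
    rw [hq']
    have h1 : bernsteinRadius l u ω ≠ 0 := by positivity
    have h2 : bernsteinRadius l u ω ^ 2 - 1 ≠ 0 := by nlinarith
    have h3 : (1 / bernsteinRadius l u ω) ^ 2 / (1 - (1 / bernsteinRadius l u ω) ^ 2) ^ 2 =
        bernsteinRadius l u ω ^ 2 / (bernsteinRadius l u ω ^ 2 - 1) ^ 2 := by
      have h4 : 1 - (1 / bernsteinRadius l u ω) ^ 2 =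
        (bernsteinRadius l u ω ^ 2 - 1) / bernsteinRadius l u ω ^ 2 := by field_simp
      rw [h4]
      field_simp
    rw [h3]
    ring
  rw [hres, ← hbound]
  refine norm_sum_mul_le hU a c _ (by positivity) fun p => ?_
  rw [norm_mul, norm_neg, norm_div, Complex.norm_ofNat, ← Complex.ofReal_sub, Complex.norm_real,
    Real.norm_of_nonneg hδ.le]
  gcongr
  simpa using hP (x p) (hx1 p)

lemma pow_apply_eq_zero_of_banded {n b : ℕ} {M : Matrix (Fin n) (Fin n) ℝ}
    (hband : ∀ a c : Fin n, (b : ℤ) < |(a : ℤ) - (c : ℤ)| → M a c = 0) (s : ℕ) :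
    ∀ a c : Fin n, (s * b : ℤ) < |(a : ℤ) - (c : ℤ)| → (M ^ s) a c = 0 := by
  induction s with
  | zero =>
    intro a c h
    refine one_apply_ne fun hac => ?_
    simp [hac] at h
  | succ s ih =>
    intro a c h
    rw [pow_succ, mul_apply]
    refine Finset.sum_eq_zero fun x _ => ?_
    by_cases h1 : (s * b : ℤ) < |(a : ℤ) - (x : ℤ)|
    · rw [ih a x h1, zero_mul]
    · rw [hband x c, mul_zero]
      have := abs_sub_le (a : ℤ) x c
      push_cast at h
      linarith

lemma sum_eigen_pow_eq {n : ℕ} {M U : Matrix (Fin n) (Fin n) ℝ} {d : Fin n → ℝ}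
    (hU : U * Uᵀ = 1) (hU' : Uᵀ * U = 1) (hM : M = U * diagonal d * Uᵀ) (s : ℕ) (a c : Fin n) :
    ∑ p, U a p * U c p * d p ^ s = (M ^ s) a c := by
  have h : M ^ s = U * diagonal (d ^ s) * Uᵀ := by
    induction s with
    | zero => simp [hU]
    | succ s ih =>
      rw [pow_succ, ih, hM]
      calc U * diagonal (d ^ s) * Uᵀ * (U * diagonal d * Uᵀ)
          = U * (diagonal (d ^ s) * (Uᵀ * U) * diagonal d) * Uᵀ := by simp only [mul_assoc]
        _ = _ := by
          rw [hU', mul_one, diagonal_mul_diagonal]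
          rfl
  rw [h, mul_apply]
  refine Finset.sum_congr rfl fun p _ => ?_
  rw [mul_diagonal, transpose_apply, Pi.pow_apply]
  ring

lemma norm_spectralResolvent_le_of_banded {n b : ℕ} (hb : 0 < b)
    {M U : Matrix (Fin n) (Fin n) ℝ} {d : Fin n → ℝ} {l u : ℝ}
    (hU : U * Uᵀ = 1) (hU' : Uᵀ * U = 1) (hM : M = U * diagonal d * Uᵀ)
    (hband : ∀ a c : Fin n, (b : ℤ) < |(a : ℤ) - (c : ℤ)| → M a c = 0)
    (hl : 0 < l) (hlu : l < u) (hdl : ∀ p, l ≤ d p) (hdu : ∀ p, d p ≤ u) (ω : ℝ)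
    {a c : Fin n} (hac : a ≠ c) :
    ‖spectralResolvent U d (ω * Complex.I) a c‖ ≤ 8 / (u - l) *
      (bernsteinRadius l u ω ^ 2 / (bernsteinRadius l u ω ^ 2 - 1) ^ 2) *
        (1 / bernsteinRadius l u ω) ^ (|(a : ℝ) - (c : ℝ)| / b - 1) := by
  obtain ⟨D, hD⟩ := Int.eq_ofNat_of_zero_le (abs_nonneg ((a : ℤ) - (c : ℤ)))
  have hD0 : 0 < D := by
    have : 0 < |(a : ℤ) - (c : ℤ)| := abs_pos.mpr (sub_ne_zero.mpr (by
      exact_mod_cast fun h => hac (Fin.ext h)))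
    omega
  have hDr : |(a : ℝ) - (c : ℝ)| = D := by exact_mod_cast congrArg (Int.cast : ℤ → ℝ) hD
  have hR := one_lt_bernsteinRadius hl hlu ω
  refine (norm_spectralResolvent_le_of_moments (k := (D - 1) / b) hU hl hlu hdl hdu ω
    fun s hs => ?_).trans ?_
  · rw [sum_eigen_pow_eq hU hU' hM]
    refine pow_apply_eq_zero_of_banded hband s a c ?_
    rw [hD]
    have : s * b ≤ D - 1 := (Nat.le_div_iff_mul_le hb).mp hs
    have : s * b < D := by omega
    exact_mod_cast this
  · have hR0 : 0 < bernsteinRadius l u ω := by linarith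
    have hδ : 0 < u - l := sub_pos.mpr hlu
    rw [← Real.rpow_natCast _ ((D - 1) / b)]
    refine mul_le_mul_of_nonneg_left (Real.rpow_le_rpow_of_exponent_ge (by positivity)
      ((div_le_one hR0).mpr hR.le) ?_) (by positivity)
    rw [hDr, sub_le_iff_le_add, div_le_iff₀ (by exact_mod_cast hb)]
    have h1 : D - 1 < b * ((D - 1) / b + 1) := Nat.lt_mul_div_succ _ hb
    have h2 : D ≤ ((D - 1) / b + 1) * b := by rw [mul_comm]; omega
    exact_mod_cast h2

lemma continuous_bernsteinRadius (l u : ℝ) : Continuous (bernsteinRadius l u) := by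
  unfold bernsteinRadius bernsteinSemiaxis
  fun_prop

lemma integrable_bernstein_majorant {l u e : ℝ} (hl : 0 < l) (hlu : l < u) (he : -1 ≤ e) :
    Integrable fun ω : ℝ => (1 / √(l ^ 2 + ω ^ 2)) *
      (bernsteinRadius l u ω ^ 2 / (bernsteinRadius l u ω ^ 2 - 1) ^ 2) *
        (1 / bernsteinRadius l u ω) ^ e := by
  have hδ : 0 < u - l := sub_pos.mpr hlu
  set r₀ : ℝ := (u + l) / (u - l)
  have hr₀ : 1 < r₀ := (one_lt_div hδ).mpr (by linarith)
  set κ : ℝ := r₀ ^ 2 / (r₀ ^ 2 - 1) with hκ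
  have hr₀' : 0 < r₀ ^ 2 - 1 := by nlinarith
  have hR1 := one_lt_bernsteinRadius hl hlu
  have hR0 : ∀ ω, 0 < bernsteinRadius l u ω := fun ω => one_pos.trans (hR1 ω)
  have hR2 : ∀ ω, 0 < bernsteinRadius l u ω ^ 2 - 1 := fun ω => by nlinarith [hR1 ω]
  have hs : ∀ ω : ℝ, 0 < √(l ^ 2 + ω ^ 2) := fun ω => Real.sqrt_pos.mpr (by positivity)
  have hcont : Continuous fun ω : ℝ => (1 / √(l ^ 2 + ω ^ 2)) *
      (bernsteinRadius l u ω ^ 2 / (bernsteinRadius l u ω ^ 2 - 1) ^ 2) *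
        (1 / bernsteinRadius l u ω) ^ e := by
    have hc := continuous_bernsteinRadius l u
    have h1 : Continuous fun ω : ℝ => 1 / √(l ^ 2 + ω ^ 2) :=
      continuous_const.div (by fun_prop) fun ω => (hs ω).ne'
    have h2 : Continuous fun ω : ℝ =>
        bernsteinRadius l u ω ^ 2 / (bernsteinRadius l u ω ^ 2 - 1) ^ 2 :=
      (hc.pow 2).div (((hc.pow 2).sub continuous_const).pow 2) fun ω => (pow_pos (hR2 ω) 2).ne'
    have h3 : Continuous fun ω : ℝ => (1 / bernsteinRadius l u ω) ^ e :=
      (continuous_const.div hc fun ω => (hR0 ω).ne').rpow_const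
        fun ω => Or.inl (one_div_pos.mpr (hR0 ω)).ne'
    exact (h1.mul h2).mul h3
  refine ((integrable_div_sq_add_sq hl).const_mul (κ ^ 2 * (u - l) / l)).mono'
    hcont.aestronglyMeasurable (Filter.Eventually.of_forall fun ω => ?_)
  have hA : √(l ^ 2 + ω ^ 2) / (u - l) ≤ bernsteinRadius l u ω := by
    refine le_trans ?_ (bernsteinSemiaxis_le_radius l u ω)
    unfold bernsteinSemiaxis
    gcongr
    exact le_add_of_nonneg_right (Real.sqrt_nonneg _)
  have hr : r₀ ≤ bernsteinRadius l u ω :=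
    (le_bernsteinSemiaxis hlu ω).trans (bernsteinSemiaxis_le_radius l u ω)
  have hpos := hR0 ω
  have hpos1 := hR1 ω
  have hpos2 := hR2 ω
  have hsω := hs ω
  have hsq : √(l ^ 2 + ω ^ 2) ^ 2 = l ^ 2 + ω ^ 2 := Real.sq_sqrt (by positivity)
  set r := bernsteinRadius l u ω
  set w := √(l ^ 2 + ω ^ 2)
  rw [Real.norm_of_nonneg (by positivity)]
  have h1 : r ^ 2 / (r ^ 2 - 1) ≤ κ := by
    rw [hκ, div_le_div_iff₀ hpos2 hr₀']
    nlinarith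
  have h2 : r ^ 2 / (r ^ 2 - 1) ^ 2 ≤ κ ^ 2 / r ^ 2 := by
    have : r ^ 2 / (r ^ 2 - 1) ^ 2 = (r ^ 2 / (r ^ 2 - 1)) ^ 2 / r ^ 2 := by field_simp
    rw [this]
    gcongr
  have h3 : (1 / r) ^ e ≤ r := by
    calc (1 / r) ^ e ≤ (1 / r) ^ (-1 : ℝ) :=
          Real.rpow_le_rpow_of_exponent_ge (by positivity) ((div_le_one hpos).mpr hpos1.le) he
      _ = r := by rw [Real.rpow_neg_one, one_div, inv_inv]
  have hκ0 : 0 < κ := by positivity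
  calc 1 / w * (r ^ 2 / (r ^ 2 - 1) ^ 2) * (1 / r) ^ e
      ≤ 1 / w * (κ ^ 2 / r ^ 2) * r := by gcongr
    _ = κ ^ 2 / w * (1 / r) := by field_simp
    _ ≤ κ ^ 2 / w * (1 / (w / (u - l))) := by gcongr
    _ = κ ^ 2 * (u - l) / l * (l / (l ^ 2 + ω ^ 2)) := by
        rw [← hsq]
        field_simp

lemma exists_orthogonal_diagonalization {n : ℕ} {M : Matrix (Fin n) (Fin n) ℝ}
    (hM : M.IsHermitian) : ∃ U : Matrix (Fin n) (Fin n) ℝ, U * Uᵀ = 1 ∧ Uᵀ * U = 1 ∧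
      M = U * diagonal hM.eigenvalues * Uᵀ := by
  refine ⟨hM.eigenvectorUnitary, ?_, ?_, ?_⟩
  · simpa [star_eq_conjTranspose] using Unitary.coe_mul_star_self hM.eigenvectorUnitary
  · simpa [star_eq_conjTranspose] using Unitary.coe_star_mul_self hM.eigenvectorUnitary
  · have h := hM.spectral_theorem
    rw [Unitary.conjStarAlgAut_apply, ← Unitary.coe_star] at h
    simpa [star_eq_conjTranspose, Function.comp_def] using h

/-- Proposition 4.1 (ii): integral bound for the entries of `S⁻¹` for `b`-banded
SPD `M`, when exactly one grid coordinate coincides. -/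
theorem kronSum_inv_entry_integral_bound_oneEqual_banded
    (n b : ℕ) (hb : 0 < b)
    (M : Matrix (Fin n) (Fin n) ℝ) (hM : M.PosDef)
    (hband : ∀ a c : Fin n, (b : ℤ) < |(a : ℤ) - (c : ℤ)| → M a c = 0)
    (lammin lammax : ℝ)
    (hmin : IsLeast (Set.range hM.1.eigenvalues) lammin)
    (hmax : IsGreatest (Set.range hM.1.eigenvalues) lammax)
    (hlt : lammin < lammax)
    (k t : ℕ) (hk1 : 1 ≤ k) (hk2 : k ≤ n * n) (ht1 : 1 ≤ t) (ht2 : t ≤ n * n)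
    (i j ℓ m : ℕ)
    (hj : j = (t - 1) / n + 1) (hi : i = t - n * ((t - 1) / n))
    (hm : m = (k - 1) / n + 1) (hl : ℓ = k - n * ((k - 1) / n))
    (hone : (i = ℓ ∧ j ≠ m) ∨ (i ≠ ℓ ∧ j = m))
    (α R : ℝ → ℝ)
    (hα : ∀ ω : ℝ, α ω =
      (Real.sqrt (lammin ^ 2 + ω ^ 2) + Real.sqrt (lammax ^ 2 + ω ^ 2)) / (lammax - lammin))
    (hR : ∀ ω : ℝ, R ω = α ω + Real.sqrt (α ω ^ 2 - 1)) :
    |(kronSum n M)⁻¹ ⟨k - 1, by omega⟩ ⟨t - 1, by omega⟩| ≤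
      (1 / (2 * Real.pi)) * (8 / (lammax - lammin)) *
        ∫ ω : ℝ, (1 / Real.sqrt (lammin ^ 2 + ω ^ 2)) *
          (R ω ^ 2 / (R ω ^ 2 - 1) ^ 2) *
          (1 / R ω) ^ (|(i : ℝ) - (ℓ : ℝ)| / b + |(j : ℝ) - (m : ℝ)| / b - 1) := by
  obtain ⟨U, hU, hU', hMU⟩ := exists_orthogonal_diagonalization hM.1
  have hdl : ∀ p, lammin ≤ hM.1.eigenvalues p := fun p => hmin.2 ⟨p, rfl⟩
  have hdu : ∀ p, hM.1.eigenvalues p ≤ lammax := fun p => hmax.2 ⟨p, rfl⟩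
  have hl0 : 0 < lammin := by
    obtain ⟨p, hp⟩ := hmin.1
    exact hp ▸ hM.eigenvalues_pos p
  have hRb : R = bernsteinRadius lammin lammax := funext fun ω => by
    rw [hR, hα]
    rfl
  have hδ : 0 < lammax - lammin := sub_pos.mpr hlt
  set kk : Fin (n * n) := ⟨k - 1, by omega⟩
  set tt : Fin (n * n) := ⟨t - 1, by omega⟩
  have hi' : i = (tt.modNat : ℕ) + 1 := by
    change i = (t - 1) % n + 1
    have := Nat.div_add_mod (t - 1) n
    omega
  have hl' : ℓ = (kk.modNat : ℕ) + 1 := by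
    change ℓ = (k - 1) % n + 1
    have := Nat.div_add_mod (k - 1) n
    omega
  have hj' : j = (tt.divNat : ℕ) + 1 := hj
  have hm' : m = (kk.divNat : ℕ) + 1 := hm
  set e : ℝ := |(i : ℝ) - (ℓ : ℝ)| / b + |(j : ℝ) - (m : ℝ)| / b - 1 with he
  have he1 : -1 ≤ e := by
    have : 0 ≤ |(i : ℝ) - (ℓ : ℝ)| / b + |(j : ℝ) - (m : ℝ)| / b := by positivity
    linarith
  rw [hRb, kronSum_inv_apply_eq_integral (hM.eigenvalues_pos) hU hU' hMU, abs_mul,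
    abs_of_pos (by positivity : 0 < 1 / (2 * π)), mul_assoc]
  refine mul_le_mul_of_nonneg_left ?_ (by positivity)
  rw [← integral_const_mul, ← Real.norm_eq_abs]
  refine norm_integral_le_of_norm_le ((integrable_bernstein_majorant hl0 hlt he1).const_mul _)
    (Filter.Eventually.of_forall fun ω => ?_)
  rw [Real.norm_eq_abs]
  refine (Complex.abs_re_le_norm _).trans ?_
  have hneg : -(ω * Complex.I) = ((-ω : ℝ) : ℂ) * Complex.I := by push_cast; ring
  rw [norm_mul, hneg]
  rcases hone with ⟨h1, h2⟩ | ⟨h1, h2⟩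
  · have hne : kk.divNat ≠ tt.divNat := fun h => h2 (by rw [hj', hm', h])
    have hee : e = |((kk.divNat : ℕ) : ℝ) - ((tt.divNat : ℕ) : ℝ)| / b - 1 := by
      rw [he, h1, hj', hm', abs_sub_comm ((kk.divNat : ℕ) : ℝ)]
      simp
    refine (mul_le_mul (norm_spectralResolvent_le hU hl0 hdl ω _ _)
      (norm_spectralResolvent_le_of_banded hb hU hU' hMU hband hl0 hlt hdl hdu (-ω) hne)
      (norm_nonneg _) (by positivity)).trans (le_of_eq ?_)
    rw [bernsteinRadius_neg, hee]
    ring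
  · have hne : kk.modNat ≠ tt.modNat := fun h => h1 (by rw [hi', hl', h])
    have hee : e = |((kk.modNat : ℕ) : ℝ) - ((tt.modNat : ℕ) : ℝ)| / b - 1 := by
      rw [he, h2, hi', hl', abs_sub_comm ((kk.modNat : ℕ) : ℝ)]
      simp
    have hR0 := one_lt_bernsteinRadius hl0 hlt ω
    refine (mul_le_mul
      (norm_spectralResolvent_le_of_banded hb hU hU' hMU hband hl0 hlt hdl hdu ω hne)
      (norm_spectralResolvent_le hU hl0 hdl (-ω) _ _)
      (norm_nonneg _) (by positivity)).trans (le_of_eq ?_)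
    rw [neg_sq, hee]
    ring
end

section
/- Let λ_max > λ_min > 0 and ω ∈ ℝ. Define α = (√(λ_min² + ω²) + √(λ_max² + ω²))/(λ_max − λ_min) and R = α + √(α² − 1). Then R > 1, R²/(R² − 1)² = 1/(4(α² − 1)), and α² − 1 ≥ (2ω² + 2 λ_max λ_min)/(λ_max − λ_min)², so that R²/(R² − 1)² ≤ (1/8) · (λ_max − λ_min)²/(ω² + λ_max λ_min). -/
open Real

/-- Basic properties of `α` and `R = α + √(α²-1)`:
`R > 1`, `R²/(R²-1)² = 1/(4(α²-1))`,
`α² - 1 ≥ (2ω² + 2λ_max λ_min)/(λ_max - λ_min)²`, and hence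
`R²/(R²-1)² ≤ (1/8)(λ_max - λ_min)²/(ω² + λ_max λ_min)`. -/
theorem alpha_R_basic_bounds
    (lammin lammax ω α R : ℝ)
    (h0 : 0 < lammin) (hlt : lammin < lammax)
    (hα : α = (Real.sqrt (lammin ^ 2 + ω ^ 2) + Real.sqrt (lammax ^ 2 + ω ^ 2)) /
      (lammax - lammin))
    (hR : R = α + Real.sqrt (α ^ 2 - 1)) :
    1 < R ∧
    R ^ 2 / (R ^ 2 - 1) ^ 2 = 1 / (4 * (α ^ 2 - 1)) ∧
    (2 * ω ^ 2 + 2 * lammax * lammin) / (lammax - lammin) ^ 2 ≤ α ^ 2 - 1 ∧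
    R ^ 2 / (R ^ 2 - 1) ^ 2 ≤ (1 / 8) * (lammax - lammin) ^ 2 / (ω ^ 2 + lammax * lammin) := by
  have hd : 0 < lammax - lammin := sub_pos.mpr hlt
  have hmax : 0 < lammax := h0.trans hlt
  have hab : 0 < lammax * lammin := mul_pos hmax h0
  have hK : 0 < ω ^ 2 + lammax * lammin := by positivity
  have hbound : (2 * ω ^ 2 + 2 * lammax * lammin) / (lammax - lammin) ^ 2 ≤ α ^ 2 - 1 := by
    have hs := Real.sq_sqrt (show 0 ≤ lammin ^ 2 + ω ^ 2 by positivity)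
    have ht := Real.sq_sqrt (show 0 ≤ lammax ^ 2 + ω ^ 2 by positivity)
    have hst := mul_nonneg (Real.sqrt_nonneg (lammin ^ 2 + ω ^ 2))
      (Real.sqrt_nonneg (lammax ^ 2 + ω ^ 2))
    rw [hα, div_pow, le_sub_iff_add_le, div_add_one (by positivity)]
    gcongr
    nlinarith
  have hA : 0 < α ^ 2 - 1 := lt_of_lt_of_le (div_pos (by linarith) (by positivity)) hbound
  have hα0 : 0 ≤ α := by rw [hα]; positivity
  have hα1 : 1 < α := by nlinarith
  have hr : 0 < Real.sqrt (α ^ 2 - 1) := Real.sqrt_pos.mpr hA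
  have hR1 : 1 < R := by linarith
  have hR0 : 0 < R := by linarith
  have hsq := Real.sq_sqrt hA.le
  have hRsq : R ^ 2 - 1 = 2 * Real.sqrt (α ^ 2 - 1) * R := by
    rw [hR]
    linear_combination -hsq
  have heq : R ^ 2 / (R ^ 2 - 1) ^ 2 = 1 / (4 * (α ^ 2 - 1)) := by
    rw [hRsq, mul_pow, mul_pow, hsq, div_eq_div_iff (by positivity) (by positivity)]
    ring
  refine ⟨hR1, heq, hbound, ?_⟩
  rw [heq, div_le_div_iff₀ (by positivity) hK]
  rw [div_le_iff₀ (by positivity)] at hbound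
  linarith
end
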